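/- Formal sphere eversion: let f₀ : S² → ℝ³ be the inclusion of the unit sphere and f₁ = −f₀. For t ∈ [0,1] and x ∈ S², let f_t(x) = (1−2t)x and let F_t(x) : T_xS² → ℝ³ be the restriction to the tangent plane T_xS² = x^⊥ of the rotation R_x^{πt} of ℝ³ by angle πt around the oriented axis ℝx. Then for every t ∈ [0,1] and x ∈ S² the linear map F_t(x) is injective, F_0(x) = df₀(x), and F_1(x) = df₁(x); hence (f_t, F_t) is a continuous homotopy of formal immersions from (f₀, df₀) to (f₁, df₁). -/

import Mathlib

open Real Function Metric
open scoped RealInnerProductSpace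

noncomputable section

abbrev E3 := EuclideanSpace ℝ (Fin 3)

/-- The cross product on `ℝ³`. -/
def cross (a b : E3) : E3 :=
  (WithLp.equiv 2 (Fin 3 → ℝ)).symm
    ![a 1 * b 2 - a 2 * b 1, a 2 * b 0 - a 0 * b 2, a 0 * b 1 - a 1 * b 0]

/-- Rodrigues' formula: the rotation `R_x^θ` of Euclidean `ℝ³` by angle `θ` about the
oriented axis spanned by the unit vector `x` (fixing `x`), applied to `v`. -/
def rot (x : E3) (θ : ℝ) (v : E3) : E3 :=
  cos θ • v + sin θ • cross x v + ((1 - cos θ) * ⟪x, v⟫) • x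

theorem cross_apply_zero (a b : E3) : cross a b 0 = a 1 * b 2 - a 2 * b 1 := rfl

theorem cross_apply_one (a b : E3) : cross a b 1 = a 2 * b 0 - a 0 * b 2 := rfl

theorem cross_apply_two (a b : E3) : cross a b 2 = a 0 * b 1 - a 1 * b 0 := rfl

theorem inner_eq_sum_three (a b : E3) : ⟪a, b⟫ = a 0 * b 0 + a 1 * b 1 + a 2 * b 2 := by
  simp [PiLp.inner_apply, Fin.sum_univ_three, mul_comm]

theorem cross_add (x v w : E3) : cross x (v + w) = cross x v + cross x w := by
  ext i
  fin_cases i <;> simp [cross] <;> ring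

theorem cross_smul (x : E3) (r : ℝ) (v : E3) : cross x (r • v) = r • cross x v := by
  ext i
  fin_cases i <;> simp [cross] <;> ring

theorem cross_self_eq_zero (x : E3) : cross x x = 0 := by
  ext i
  fin_cases i <;> simp [cross] <;> ring

theorem inner_self_cross (x v : E3) : ⟪x, cross x v⟫ = 0 := by
  rw [inner_eq_sum_three, cross_apply_zero, cross_apply_one, cross_apply_two]
  ring

theorem cross_cross_self (x v : E3) : cross x (cross x v) = ⟪x, v⟫ • x - ⟪x, x⟫ • v := by
  rw [inner_eq_sum_three, inner_eq_sum_three]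
  ext i
  fin_cases i <;> simp [cross] <;> ring

theorem continuous_cross : Continuous fun q : E3 × E3 => cross q.1 q.2 := by
  refine (PiLp.continuous_toLp 2 _).comp (continuous_pi fun i => ?_)
  fin_cases i <;> simp <;> fun_prop

theorem isLinearMap_rot (x : E3) (θ : ℝ) : IsLinearMap ℝ (rot x θ) where
  map_add v w := by
    simp only [rot, cross_add, inner_add_right]
    module
  map_smul r v := by
    simp only [rot, cross_smul, real_inner_smul_right]
    module

theorem rot_neg_rot {x : E3} (hx : ⟪x, x⟫ = 1) (θ : ℝ) (v : E3) :
    rot x (-θ) (rot x θ v) = v := by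
  simp only [rot, cos_neg, sin_neg, cross_add, cross_smul, cross_self_eq_zero, cross_cross_self,
    inner_add_right, real_inner_smul_right, inner_self_cross, hx]
  match_scalars
  · linear_combination sin_sq_add_cos_sq θ
  · ring
  · linear_combination -⟪x, v⟫ * sin_sq_add_cos_sq θ

theorem rot_injective {x : E3} (hx : ⟪x, x⟫ = 1) (θ : ℝ) : Injective (rot x θ) :=
  LeftInverse.injective (rot_neg_rot hx θ)

theorem rot_zero (x v : E3) : rot x 0 v = v := by
  simp [rot]

theorem rot_pi_of_inner_eq_zero {x v : E3} (h : ⟪x, v⟫ = 0) : rot x π v = -v := by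
  simp [rot, h]

theorem continuous_rot {X : Type*} [TopologicalSpace X] {x v : X → E3} {θ : X → ℝ}
    (hx : Continuous x) (hθ : Continuous θ) (hv : Continuous v) :
    Continuous fun q => rot (x q) (θ q) (v q) := by
  have h : Continuous fun q => cross (x q) (v q) := continuous_cross.comp (hx.prodMk hv)
  unfold rot
  fun_prop

/-- **Formal sphere eversion.**  With `f t x = (1 - 2t) • x` and
`F t x = (R_x^{πt})|_{x^⊥} : T_xS² = x^⊥ → ℝ³`:
every `F t x` is injective, `F 0 x = df₀(x) = id_{x^⊥}`, `F 1 x = df₁(x) = -id_{x^⊥}`,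
and all the data depend continuously on `(t, x, v)`; hence `(f_t, F_t)` is a continuous
homotopy of formal immersions from `(f₀, df₀)` to `(f₁, df₁) = (-f₀, -df₀)`. -/
theorem formal_sphere_eversion :
    (∀ t ∈ Set.Icc (0 : ℝ) 1, ∀ x ∈ sphere (0 : E3) 1,
      ∀ v ∈ (ℝ ∙ x)ᗮ, ∀ w ∈ (ℝ ∙ x)ᗮ, rot x (π * t) v = rot x (π * t) w → v = w) ∧
    (∀ x ∈ sphere (0 : E3) 1, ∀ t : ℝ, IsLinearMap ℝ (rot x (π * t))) ∧
    (∀ x ∈ sphere (0 : E3) 1, ∀ v ∈ (ℝ ∙ x)ᗮ, rot x (π * 0) v = v) ∧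
    (∀ x ∈ sphere (0 : E3) 1, ∀ v ∈ (ℝ ∙ x)ᗮ, rot x (π * 1) v = -v) ∧
    Continuous (fun q : ℝ × E3 => (1 - 2 * q.1) • q.2) ∧
    Continuous (fun q : ℝ × E3 × E3 => rot q.2.1 (π * q.1) q.2.2) := by
  refine ⟨fun t _ x hx v _ w _ h => rot_injective ?_ _ h, fun x _ t => isLinearMap_rot x _,
    fun x _ v _ => ?_, fun x _ v hv => ?_, by fun_prop, ?_⟩
  · rw [real_inner_self_eq_norm_sq, mem_sphere_zero_iff_norm.mp hx, one_pow]
  · rw [mul_zero, rot_zero]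
  · rw [mul_one, rot_pi_of_inner_eq_zero (Submodule.mem_orthogonal_singleton_iff_inner_right.mp hv)]
  · exact continuous_rot (by fun_prop) (by fun_prop) (by fun_prop)

end
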